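/- arXiv:2108.13147 — 3 statements merged into one kernel-verified Lean document; each statement's English description precedes it below -/
import Mathlib

section
/- Let X be a locally connected topological space, f : X → ℝ a continuous function, t ∈ ℝ, and let U be a connected component of the open sublevel set f⁻¹((−∞, t)). Then every point x in the frontier (boundary) of U satisfies f(x) = t. -/
/-- In a locally connected space, every point in the frontier of a connected
component `U` of the open sublevel set `f ⁻¹' (-∞, t)` of a continuous
function `f` satisfies `f x = t`. -/
theorem frontier_component_open_sublevel_eq {X : Type*} [TopologicalSpace X]
    [LocallyConnectedSpace X] (f : X → ℝ) (hf : Continuous f) (t : ℝ)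
    (U : Set X)
    (hU : ∃ x₀ ∈ f ⁻¹' Set.Iio t, U = connectedComponentIn (f ⁻¹' Set.Iio t) x₀)
    (x : X) (hx : x ∈ frontier U) : f x = t := by
  obtain ⟨x₀, hx₀, rfl⟩ := hU
  have hF : IsOpen (f ⁻¹' Set.Iio t) := isOpen_Iio.preimage hf
  have hopen : IsOpen (connectedComponentIn (f ⁻¹' Set.Iio t) x₀) := hF.connectedComponentIn
  rw [hopen.frontier_eq] at hx
  obtain ⟨hcl, hnot⟩ := hx
  have hsub := connectedComponentIn_subset (f ⁻¹' Set.Iio t) x₀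
  have hle : f x ≤ t :=
    closure_minimal (fun y hy => le_of_lt (hsub hy)) (isClosed_le hf continuous_const) hcl
  refine le_antisymm hle (not_lt.1 fun hlt => hnot ?_)
  have hpre : IsPreconnected (insert x (connectedComponentIn (f ⁻¹' Set.Iio t) x₀)) :=
    isPreconnected_connectedComponentIn.subset_closure (Set.subset_insert _ _)
      (Set.insert_subset hcl subset_closure)
  exact hpre.subset_connectedComponentIn
    (Set.mem_insert_of_mem _ (mem_connectedComponentIn hx₀))
    (Set.insert_subset hlt hsub) (Set.mem_insert _ _)
end

section
/- Let X be a locally connected topological space, f : X → ℝ a continuous function, t₀ ≤ t₁ real numbers, and let U be a connected component of the open sublevel set f⁻¹((−∞, t₁)) on which f(x) ≥ t₀ for all x ∈ U. Define g : X → ℝ by g(x) = t₁ for x ∈ U and g(x) = f(x) for x ∉ U. Then g is continuous and satisfies 0 ≤ g(x) − f(x) ≤ t₁ − t₀ for all x ∈ X. -/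
/-- Flattening a continuous function `f` to the value `t₁` on a connected
component `U` of its open sublevel set at height `t₁`, on which `f ≥ t₀`,
produces a continuous function `g` with `0 ≤ g - f ≤ t₁ - t₀`. -/
theorem continuous_flattened_on_component {X : Type*} [TopologicalSpace X]
    [LocallyConnectedSpace X] (f : X → ℝ) (hf : Continuous f)
    (t₀ t₁ : ℝ) (ht : t₀ ≤ t₁) (U : Set X)
    (hU : ∃ x₀ ∈ f ⁻¹' Set.Iio t₁, U = connectedComponentIn (f ⁻¹' Set.Iio t₁) x₀)
    (hlow : ∀ x ∈ U, t₀ ≤ f x)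
    (g : X → ℝ) (hgU : ∀ x ∈ U, g x = t₁) (hg : ∀ x ∉ U, g x = f x) :
    Continuous g ∧ ∀ x, 0 ≤ g x - f x ∧ g x - f x ≤ t₁ - t₀ := by
  classical
  obtain ⟨x₀, hx₀, hUeq⟩ := hU
  have hopen : IsOpen (f ⁻¹' Set.Iio t₁) := isOpen_Iio.preimage hf
  have hUo : IsOpen U := hUeq ▸ hopen.connectedComponentIn
  have hlt : ∀ x ∈ U, f x < t₁ := by
    intro x hx
    rw [hUeq] at hx
    exact connectedComponentIn_subset (f ⁻¹' Set.Iio t₁) x₀ hx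
  refine ⟨?_, ?_⟩
  · have hgeq : g = U.piecewise (fun _ => t₁) f := by
      funext x
      by_cases hx : x ∈ U
      · simp [hx, hgU x hx]
      · simp [hx, hg x hx]
    rw [hgeq]
    refine Continuous.piecewise ?_ continuous_const hf
    intro a ha
    rw [hUo.frontier_eq] at ha
    obtain ⟨hac, haU⟩ := ha
    have hle : f a ≤ t₁ :=
      closure_minimal (fun x hx => (hlt x hx).le) (isClosed_le hf continuous_const) hac
    by_contra hne
    have halt : a ∈ f ⁻¹' Set.Iio t₁ := lt_of_le_of_ne hle (Ne.symm hne)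
    have hmem : a ∈ connectedComponentIn (f ⁻¹' Set.Iio t₁) a := mem_connectedComponentIn halt
    obtain ⟨y, hya, hyU⟩ := mem_closure_iff.1 hac _ hopen.connectedComponentIn hmem
    rw [hUeq] at hyU
    apply haU
    rw [hUeq, connectedComponentIn_eq hyU, ← connectedComponentIn_eq hya]
    exact hmem
  · intro x
    by_cases hx : x ∈ U
    · have h1 := hlt x hx
      have h2 := hlow x hx
      rw [hgU x hx]
      constructor <;> linarith
    · rw [hg x hx]
      constructor <;> linarith
end

section
/- Let a ≤ b be real numbers, f : [a, b] → ℝ continuous on the compact interval [a, b] ⊆ ℝ, t ∈ ℝ, and x₀ ∈ [a, b] with f(x₀) ≤ t. For s ∈ ℝ let U_s denote the connected component of x₀ in the closed sublevel set {x ∈ [a, b] : f(x) ≤ s}. Then the intersection over all s > t of the sets U_s equals U_t, the connected component of x₀ in {x ∈ [a, b] : f(x) ≤ t}; in particular this intersection is a nonempty compact interval. -/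
theorem mem_component_iff_uIcc {F : Set ℝ} {x y : ℝ} (hx : x ∈ F) :
    y ∈ connectedComponentIn F x ↔ Set.uIcc x y ⊆ F := by
  constructor
  · intro hy
    exact (isPreconnected_connectedComponentIn.ordConnected.uIcc_subset
      (mem_connectedComponentIn hx) hy).trans (connectedComponentIn_subset F x)
  · intro h
    exact (isPreconnected_uIcc.subset_connectedComponentIn Set.left_mem_uIcc h) Set.right_mem_uIcc

/-- For a continuous function `f` on `[a, b] ⊆ ℝ` and `x₀` with `f x₀ ≤ t`,
the intersection over all `s > t` of the connected components of `x₀` in the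
closed sublevel sets at heights `s` equals the connected component of `x₀` in
the closed sublevel set at height `t`; in particular this intersection is a
nonempty compact interval. -/
theorem component_intersection_at_critical_value (a b : ℝ) (hab : a ≤ b)
    (f : ℝ → ℝ) (hf : ContinuousOn f (Set.Icc a b)) (t : ℝ)
    (x₀ : ℝ) (hx₀ : x₀ ∈ Set.Icc a b) (hfx₀ : f x₀ ≤ t) :
    (⋂ s ∈ Set.Ioi t, connectedComponentIn {x ∈ Set.Icc a b | f x ≤ s} x₀) =
      connectedComponentIn {x ∈ Set.Icc a b | f x ≤ t} x₀ ∧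
    (⋂ s ∈ Set.Ioi t, connectedComponentIn {x ∈ Set.Icc a b | f x ≤ s} x₀).Nonempty ∧
    IsCompact (⋂ s ∈ Set.Ioi t, connectedComponentIn {x ∈ Set.Icc a b | f x ≤ s} x₀) ∧
    ∃ c d : ℝ,
      (⋂ s ∈ Set.Ioi t, connectedComponentIn {x ∈ Set.Icc a b | f x ≤ s} x₀) =
        Set.Icc c d := by
  have key : (⋂ s ∈ Set.Ioi t, connectedComponentIn {x ∈ Set.Icc a b | f x ≤ s} x₀) =
      connectedComponentIn {x ∈ Set.Icc a b | f x ≤ t} x₀ := by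
    apply Set.Subset.antisymm
    · intro y hy
      rw [Set.mem_iInter₂] at hy
      have h : ∀ s, t < s → Set.uIcc x₀ y ⊆ {x ∈ Set.Icc a b | f x ≤ s} := fun s hs =>
        (mem_component_iff_uIcc (F := {x ∈ Set.Icc a b | f x ≤ s}) ⟨hx₀, hfx₀.trans (le_of_lt hs)⟩).1 (hy s hs)
      refine (mem_component_iff_uIcc (F := {x ∈ Set.Icc a b | f x ≤ t}) ⟨hx₀, hfx₀⟩).2 fun z hz => ⟨?_, ?_⟩
      · exact (h (t + 1) (by linarith) hz).1
      · exact le_of_forall_gt_imp_ge_of_dense fun s hs => (h s hs hz).2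
    · refine Set.subset_iInter₂ fun s hs => connectedComponentIn_mono _ ?_
      exact fun z hz => ⟨hz.1, hz.2.trans (le_of_lt hs)⟩
  rw [key]
  have hmem : x₀ ∈ {x ∈ Set.Icc a b | f x ≤ t} := ⟨hx₀, hfx₀⟩
  have hclosed : IsClosed {x ∈ Set.Icc a b | f x ≤ t} :=
    isClosed_Icc.isClosed_le hf continuousOn_const
  have hconn := isConnected_connectedComponentIn_iff.2 hmem
  have hcl : IsClosed (connectedComponentIn {x ∈ Set.Icc a b | f x ≤ t} x₀) := by
    apply isClosed_of_closure_subset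
    exact hconn.isPreconnected.closure.subset_connectedComponentIn
      (subset_closure (mem_connectedComponentIn hmem))
      (closure_minimal (connectedComponentIn_subset _ _) hclosed)
  have hcomp : IsCompact (connectedComponentIn {x ∈ Set.Icc a b | f x ≤ t} x₀) :=
    isCompact_Icc.of_isClosed_subset hcl
      ((connectedComponentIn_subset _ _).trans fun z hz => hz.1)
  exact ⟨rfl, hconn.nonempty, hcomp, _, _, eq_Icc_of_connected_compact hconn hcomp⟩
end
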